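/- The Gauss hypergeometric series satisfies ₂F₁(1/2, 3/4; 5/4; 80/81) = (9/200) · 5^{3/4} · Γ(1/4)⁴ / π², where Γ denotes the Gamma function. -/

import Mathlib

open scoped Nat

/-- Pochhammer symbol (rising factorial) on the reals. -/
noncomputable def poch (a : ℝ) (n : ℕ) : ℝ := ∏ i ∈ Finset.range n, (a + i)

/-- Gauss hypergeometric series ₂F₁(a,b;c;x) as a real series. -/
noncomputable def twoFone (a b c x : ℝ) : ℝ :=
  ∑' n : ℕ, poch a n * poch b n / (poch c n * (n ! : ℝ)) * x ^ n

open MeasureTheory Set in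
lemma subst01 (ph ph' f g : ℝ → ℝ) (hc : ContinuousOn ph (Icc 0 1)) (h0 : ph 0 = 0) (h1 : ph 1 = 1)
    (hd : ∀ t ∈ Ioo (0:ℝ) 1, HasDerivAt ph (ph' t) t) (hp : ∀ t ∈ Ioo (0:ℝ) 1, 0 < ph' t)
    (hg : ∀ t ∈ Ioo (0:ℝ) 1, ph' t * f (ph t) = g t) :
    (IntegrableOn f (Ioo 0 1) ↔ IntegrableOn g (Ioo 0 1)) ∧
      ∫ x in Ioo (0:ℝ) 1, f x = ∫ x in Ioo (0:ℝ) 1, g x := by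
  have hm : StrictMonoOn ph (Icc 0 1) := by
    apply strictMonoOn_of_deriv_pos (convex_Icc 0 1) hc
    intro t ht
    rw [interior_Icc] at ht
    rw [(hd t ht).deriv]
    exact hp t ht
  have him : ph '' Ioo 0 1 = Ioo 0 1 := by
    apply Subset.antisymm
    · rintro _ ⟨t, ht, rfl⟩
      constructor
      · rw [← h0]; exact hm (by simp) ⟨ht.1.le, ht.2.le⟩ ht.1
      · rw [← h1]; exact hm ⟨ht.1.le, ht.2.le⟩ (by simp) ht.2
    · have := intermediate_value_Ioo (zero_le_one (α := ℝ)) hc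
      rwa [h0, h1] at this
  have hinj : InjOn ph (Ioo 0 1) := hm.injOn.mono Ioo_subset_Icc_self
  have hd' : ∀ t ∈ Ioo (0:ℝ) 1, HasDerivWithinAt ph (ph' t) (Ioo 0 1) t :=
    fun t ht => (hd t ht).hasDerivWithinAt
  have hcg : ∀ t ∈ Ioo (0:ℝ) 1, |ph' t| • f (ph t) = g t := by
    intro t ht
    rw [abs_of_pos (hp t ht), smul_eq_mul, hg t ht]
  have e1 := integrableOn_image_iff_integrableOn_abs_deriv_smul measurableSet_Ioo hd' hinj f
  have e2 := integral_image_eq_integral_abs_deriv_smul measurableSet_Ioo hd' hinj f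
  rw [him] at e1 e2
  constructor
  · rw [e1]; exact integrableOn_congr_fun hcg measurableSet_Ioo
  · rw [e2]; exact setIntegral_congr_fun measurableSet_Ioo hcg

open MeasureTheory Set ProbabilityTheory in
lemma beta_int (a b : ℝ) (ha : 0 < a) (hb : 0 < b) :
    IntegrableOn (fun x : ℝ => x ^ (a - 1) * (1 - x) ^ (b - 1)) (Ioo 0 1) ∧
      ∫ x in Ioo (0:ℝ) 1, x ^ (a - 1) * (1 - x) ^ (b - 1) = beta a b := by
  have hI := Complex.betaIntegral_convergent (u := a) (v := b) (by simpa) (by simpa)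
  rw [intervalIntegrable_iff_integrableOn_Ioc_of_le (by simp)] at hI
  have hcg : ∀ x ∈ Ioc (0:ℝ) 1, RCLike.re ((x:ℂ) ^ ((a:ℂ) - 1) * (1 - (x:ℂ)) ^ ((b:ℂ) - 1))
      = x ^ (a - 1) * (1 - x) ^ (b - 1) := by
    intro x hx
    norm_cast
    rw [← Complex.ofReal_cpow hx.1.le, ← Complex.ofReal_cpow (by linarith [hx.2]),
      RCLike.re_to_complex, Complex.re_mul_ofReal, Complex.ofReal_re]
  constructor
  · rw [← integrableOn_Ioc_iff_integrableOn_Ioo]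
    exact (integrableOn_congr_fun hcg measurableSet_Ioc).1 hI.re
  · rw [beta_eq_betaIntegralReal a b ha hb, Complex.betaIntegral,
      intervalIntegral.integral_of_le (by norm_num), ← integral_Ioc_eq_integral_Ioo,
      ← RCLike.re_to_complex, ← integral_re hI]
    exact (setIntegral_congr_fun measurableSet_Ioc hcg).symm

open MeasureTheory Set ProbabilityTheory in
lemma mono_int (m : ℕ) :
    IntegrableOn (fun s : ℝ => s ^ m / √(1 - s ^ 4)) (Ioo 0 1) ∧
      ∫ s in Ioo (0:ℝ) 1, s ^ m / √(1 - s ^ 4) = beta ((m + 1) / 4) (1 / 2) / 4 := by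
  obtain ⟨h1, h2⟩ := beta_int ((m + 1) / 4) (1 / 2) (by positivity) (by norm_num)
  have := subst01 (fun s => s ^ 4) (fun s => 4 * s ^ 3)
    (fun x : ℝ => x ^ (((m:ℝ) + 1) / 4 - 1) * (1 - x) ^ ((1:ℝ) / 2 - 1))
    (fun s => 4 * (s ^ m / √(1 - s ^ 4))) (by fun_prop) (by norm_num) (by norm_num)
    (fun t _ => by simpa using hasDerivAt_pow 4 t) (fun t ht => by have := ht.1; positivity) (by
      intro t ht
      have ht0 := ht.1
      have h4 : t ^ 4 < 1 := pow_lt_one₀ ht0.le ht.2 (by norm_num)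
      have e1 : (t ^ 4) ^ (((m:ℝ) + 1) / 4 - 1) = t ^ m / t ^ 3 := by
        rw [← Real.rpow_natCast, ← Real.rpow_mul ht0.le,
          show ((4:ℕ):ℝ) * (((m:ℝ) + 1) / 4 - 1) = (m:ℝ) - (3:ℕ) by push_cast; ring,
          Real.rpow_sub ht0, Real.rpow_natCast, Real.rpow_natCast]
      have e2 : (1 - t ^ 4) ^ ((1:ℝ) / 2 - 1) = 1 / √(1 - t ^ 4) := by
        rw [show (1:ℝ) / 2 - 1 = - (1 / 2) by norm_num, Real.rpow_neg (by linarith),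
          Real.sqrt_eq_rpow, one_div ((1 - t ^ 4) ^ _)]
      simp only [e1, e2]
      field_simp)
  obtain ⟨h3, h4⟩ := this
  rw [h3] at h1
  constructor
  · have := h1.const_mul (1/4)
    refine (integrableOn_congr_fun ?_ measurableSet_Ioo).1 this
    intro x _; ring
  · rw [← h2, h4, integral_const_mul]; ring
lemma poch_succ (a : ℝ) (n : ℕ) : poch a (n + 1) = poch a n * (a + n) := by
  simp [poch, Finset.prod_range_succ]

lemma poch_pos (a : ℝ) (ha : 0 < a) (n : ℕ) : 0 < poch a n :=
  Finset.prod_pos fun i _ => by positivity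

lemma choose_poch (a : ℝ) (n : ℕ) : Ring.choose (a + n - 1) n = poch a n / (n ! : ℝ) := by
  have h1 : (n ! : ℝ) * Ring.multichoose a n = poch a n := by
    have := Ring.factorial_nsmul_multichoose_eq_ascPochhammer a n
    rw [nsmul_eq_mul, Polynomial.ascPochhammer_smeval_eq_eval] at this
    rw [this]
    clear this
    induction n with
    | zero => simp [poch]
    | succ n ih => rw [ascPochhammer_succ_eval, ih, poch_succ]
  have h2 : Ring.choose (a + n - 1) n = Ring.multichoose a n := by
    rw [Ring.choose]; congr 1; ring
  rw [h2, ← h1]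
  field_simp

lemma binom_sum (x : ℝ) (h0 : 0 ≤ x) (h1 : x < 1) :
    HasSum (fun n : ℕ => poch (1/2) n / (n ! : ℝ) * x ^ n) (1 / √(1 - x)) := by
  have := (Real.one_div_one_sub_rpow_hasFPowerSeriesOnBall_zero (1/2)).hasSum (y := x) (by
    simp [enorm_eq_nnnorm, ← NNReal.coe_lt_coe, abs_of_nonneg h0, h1])
  simp only [zero_add] at this
  rw [Real.sqrt_eq_rpow]
  simp only [FormalMultilinearSeries.ofScalars_apply_eq, choose_poch, smul_eq_mul] at this
  exact this

open ProbabilityTheory in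
lemma beta_ratio (n : ℕ) : beta (((4 * n + 2 : ℕ) + 1) / 4) (1/2) =
    beta (3/4) (1/2) * (poch (3/4) n / poch (5/4) n) := by
  have hG : ∀ (a : ℝ), 0 < a → ∀ n : ℕ, Real.Gamma (a + n) = Real.Gamma a * poch a n := by
    intro a ha n
    induction n with
    | zero => simp [poch]
    | succ n ih =>
      rw [poch_succ, Nat.cast_succ, ← add_assoc, Real.Gamma_add_one (by positivity), ih]; ring
  unfold beta
  have e1 : ((4 * n + 2 : ℕ) + 1 : ℝ) / 4 = 3/4 + n := by push_cast; ring
  rw [e1, show (3/4 + (n:ℝ) + 1/2) = 5/4 + n by ring, hG _ (by norm_num), hG _ (by norm_num),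
    show (3/4 + 1/2 : ℝ) = 5/4 by norm_num]
  have := (poch_pos (5/4) (by norm_num) n).ne'
  have := (Real.Gamma_pos_of_pos (show (0:ℝ) < 5/4 by norm_num)).ne'
  field_simp

open MeasureTheory Set ProbabilityTheory in
lemma series_int : twoFone (1/2) (3/4) (5/4) (80/81) * (beta (3/4) (1/2) / 4) =
    ∫ s in Ioo (0:ℝ) 1, s ^ 2 / √((1 - s ^ 4) * (1 - 80/81 * s ^ 4)) := by
  set F : ℕ → ℝ → ℝ := fun n s =>
    (poch (1/2) n / (n ! : ℝ) * (80/81) ^ n) * (s ^ (4 * n + 2) / √(1 - s ^ 4)) with hF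
  have hint : ∀ n, IntegrableOn (F n) (Ioo 0 1) := fun n => (mono_int (4 * n + 2)).1.const_mul _
  have hval : ∀ n, ∫ s in Ioo (0:ℝ) 1, F n s = poch (1/2) n * poch (3/4) n /
      (poch (5/4) n * (n ! : ℝ)) * (80/81) ^ n * (beta (3/4) (1/2) / 4) := by
    intro n
    rw [hF, integral_const_mul, (mono_int (4 * n + 2)).2, beta_ratio]
    have := (poch_pos (5/4) (by norm_num) n).ne'
    field_simp
  have hpos : ∀ n, ∀ s ∈ Ioo (0:ℝ) 1, 0 ≤ F n s := by
    intro n s hs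
    have := poch_pos (1/2) (by norm_num) n
    have := hs.1
    simp only [hF]
    positivity
  have hnorm : ∀ n, ∫ s in Ioo (0:ℝ) 1, ‖F n s‖ = ∫ s in Ioo (0:ℝ) 1, F n s := by
    intro n
    apply setIntegral_congr_fun measurableSet_Ioo
    intro s hs
    exact Real.norm_of_nonneg (hpos n s hs)
  have hb : 0 < beta (3/4) (1/2) := beta_pos (by norm_num) (by norm_num)
  have hsum : Summable fun n => ∫ s in Ioo (0:ℝ) 1, ‖F n s‖ := by
    simp_rw [hnorm, hval]
    apply Summable.mul_right
    have hs := (binom_sum (80/81) (by norm_num) (by norm_num)).summable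
    refine Summable.of_nonneg_of_le ?_ ?_ hs
    · intro n
      have := poch_pos (1/2) (by norm_num) n
      have := poch_pos (3/4) (by norm_num) n
      have := poch_pos (5/4) (by norm_num) n
      positivity
    · intro n
      have h1 := poch_pos (1/2) (by norm_num) n
      have h2 := poch_pos (3/4) (by norm_num) n
      have h3 := poch_pos (5/4) (by norm_num) n
      have h4 : poch (3/4) n ≤ poch (5/4) n := by
        apply Finset.prod_le_prod
        · intro i _; positivity
        · intro i _; linarith
      gcongr ?_ * _
      rw [div_le_div_iff₀ (by positivity) (by positivity)]
      have : (0:ℝ) < n ! := by positivity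
      nlinarith [mul_le_mul_of_nonneg_left h4 (mul_pos h1 this).le]
  have key := integral_tsum_of_summable_integral_norm hint hsum
  simp_rw [hval] at key
  rw [tsum_mul_right] at key
  rw [twoFone, key]
  apply setIntegral_congr_fun measurableSet_Ioo
  intro s hs
  have h4 : s ^ 4 < 1 := pow_lt_one₀ hs.1.le hs.2 (by norm_num)
  have h40 : 0 < s ^ 4 := pow_pos hs.1 4
  have := (binom_sum (80/81 * s ^ 4) (by positivity) (by linarith)).mul_right (s ^ 2 / √(1 - s ^ 4))
  have h5 : (fun n => F n s) = fun n =>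
      poch (1/2) n / (n ! : ℝ) * (80/81 * s ^ 4) ^ n * (s ^ 2 / √(1 - s ^ 4)) := by
    funext n
    simp only [hF]
    rw [mul_pow, pow_add, pow_mul]; ring
  simp only
  rw [h5, this.tsum_eq, Real.sqrt_mul (by linarith)]
  field_simp
lemma pt_helper (A T W m d : ℝ) (hA : A = T * W ^ 2) (hW : 0 < W) (hT : 0 ≤ T)
    (hd : d = m * W) : d * (1 / √A) = m * (1 / √T) := by
  rw [hA, hd, Real.sqrt_mul hT, Real.sqrt_sq hW.le]
  field_simp

open MeasureTheory Set in
lemma subP1 (k : ℝ) (h0 : 0 < k) (h1 : k < 1) :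
    (IntegrableOn (fun v : ℝ => 1 / √((1 - v^2) * (1 + ((1-k)/(1+k))^2 * v^2))) (Ioo 0 1) ↔
    IntegrableOn (fun s : ℝ => (1+k)*(1-k*s^2) * (1 / √((1 - s^4) * (1 - k^4*s^4)))) (Ioo 0 1)) ∧
    ∫ v in Ioo (0:ℝ) 1, 1 / √((1 - v^2) * (1 + ((1-k)/(1+k))^2 * v^2)) =
    ∫ s in Ioo (0:ℝ) 1, (1+k)*(1-k*s^2) * (1 / √((1 - s^4) * (1 - k^4*s^4))) := by
  have hs2 : ∀ t ∈ Ioo (0:ℝ) 1, t^2 < 1 := fun t ht => pow_lt_one₀ ht.1.le ht.2 (by norm_num)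
  have hs4 : ∀ t ∈ Ioo (0:ℝ) 1, t^4 < 1 := fun t ht => pow_lt_one₀ ht.1.le ht.2 (by norm_num)
  apply subst01 (fun s => (1+k)*s/(1+k*s^2)) (fun s => (1+k)*(1-k*s^2)/(1+k*s^2)^2)
  · apply ContinuousOn.div (by fun_prop) (by fun_prop)
    intro x _; positivity
  · simp
  · field_simp
  · intro t ht
    have hD : (1 + k * t^2) ≠ 0 := by positivity
    have := ((hasDerivAt_id' t).const_mul (1+k)).div
      (((hasDerivAt_pow 2 t).const_mul k).const_add 1) hD
    refine HasDerivAt.congr_deriv this ?_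
    congr 1
    push_cast; ring
  · intro t ht
    have : 0 < 1 - k*t^2 := by nlinarith [hs2 t ht]
    positivity
  · intro t ht
    have h5 := hs2 t ht
    have h6 := hs4 t ht
    have h3 : 0 < 1 - k*t^2 := by nlinarith
    have h7 : k^4 < 1 := pow_lt_one₀ h0.le h1 (by norm_num)
    have h8 : 0 < 1 - k^4*t^4 := by nlinarith [pow_pos ht.1 4]
    have hD : 0 < (1 + k * t^2) := by positivity
    have := pt_helper ((1 - ((1+k)*t/(1+k*t^2))^2) * (1 + ((1-k)/(1+k))^2 * ((1+k)*t/(1+k*t^2))^2))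
      ((1 - t^4) * (1 - k^4*t^4)) (1/(1+k*t^2)^2) ((1+k)*(1-k*t^2)) ((1+k)*(1-k*t^2)/(1+k*t^2)^2)
      (by field_simp; ring) (by positivity) (mul_nonneg (by linarith) h8.le) (by ring)
    exact this

open MeasureTheory Set in
lemma subQ1 (k : ℝ) (h0 : 0 < k) (h1 : k < 1) :
    (IntegrableOn (fun v : ℝ => 1 / √((1 - v^2) * (((1-k)/(1+k))^2 + v^2))) (Ioo 0 1) ↔
    IntegrableOn (fun s : ℝ => (1+k)*(1+k*s^2) * (1 / √((1 - s^4) * (1 - k^4*s^4)))) (Ioo 0 1)) ∧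
    ∫ v in Ioo (0:ℝ) 1, 1 / √((1 - v^2) * (((1-k)/(1+k))^2 + v^2)) =
    ∫ s in Ioo (0:ℝ) 1, (1+k)*(1+k*s^2) * (1 / √((1 - s^4) * (1 - k^4*s^4))) := by
  have hs2 : ∀ t ∈ Ioo (0:ℝ) 1, t^2 < 1 := fun t ht => pow_lt_one₀ ht.1.le ht.2 (by norm_num)
  have hs4 : ∀ t ∈ Ioo (0:ℝ) 1, t^4 < 1 := fun t ht => pow_lt_one₀ ht.1.le ht.2 (by norm_num)
  have hk : 0 < 1 - k := by linarith
  apply subst01 (fun s => (1-k)*s/(1-k*s^2)) (fun s => (1-k)*(1+k*s^2)/(1-k*s^2)^2)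
  · apply ContinuousOn.div (by fun_prop) (by fun_prop)
    intro x hx
    have : x^2 ≤ 1 := pow_le_one₀ hx.1 hx.2
    have : 0 < 1 - k*x^2 := by nlinarith
    exact this.ne'
  · simp
  · field_simp
  · intro t ht
    have hD : (1 - k * t^2) ≠ 0 := by nlinarith [hs2 t ht]
    have := ((hasDerivAt_id' t).const_mul (1-k)).div
      (((hasDerivAt_pow 2 t).const_mul k).const_sub 1) hD
    refine HasDerivAt.congr_deriv this ?_
    congr 1
    push_cast; ring
  · intro t ht
    have : 0 < 1 - k*t^2 := by nlinarith [hs2 t ht]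
    positivity
  · intro t ht
    have h5 := hs2 t ht
    have h6 := hs4 t ht
    have h3 : 0 < 1 - k*t^2 := by nlinarith
    have h7 : k^4 < 1 := pow_lt_one₀ h0.le h1 (by norm_num)
    have h8 : 0 < 1 - k^4*t^4 := by nlinarith [pow_pos ht.1 4]
    have := pt_helper ((1 - ((1-k)*t/(1-k*t^2))^2) * (((1-k)/(1+k))^2 + ((1-k)*t/(1-k*t^2))^2))
      ((1 - t^4) * (1 - k^4*t^4)) ((1-k)/(1+k)/(1-k*t^2)^2) ((1+k)*(1+k*t^2)) ((1-k)*(1+k*t^2)/(1-k*t^2)^2)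
      (by field_simp; ring) (by positivity) (mul_nonneg (by linarith) h8.le) (by field_simp)
    exact this

open MeasureTheory Set in
/-- Degree five substitution, generic form. -/
lemma subRat (a0 a1 a2 b1 b2 f1 f2 g1 g2 e s m q : ℝ)
    (hsum : a0 + a1 + a2 = 1 + b1 + b2) (he : 0 < e) (hm : 0 < a0) (hq : q * e = 1)
    (hma : m * e = a0)
    (hD : ∀ t : ℝ, 0 ≤ t → t ≤ 1 → 0 < 1 + b1*t^2 + b2*t^4)
    (hF : ∀ t : ℝ, 0 ≤ t → t ≤ 1 → 0 < 1 + f1*t^2 + f2*t^4)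
    (hG : ∀ t : ℝ, 0 ≤ t → t ≤ 1 → 0 < 1 + g1*t^2 + g2*t^4)
    (hs : 0 ≤ s)
    (h1 : ∀ t : ℝ, (1 + b1*t^2 + b2*t^4)^2 - (a0*t+a1*t^3+a2*t^5)^2 =
      (1 - t^2) * (1 + f1*t^2 + f2*t^4)^2)
    (h2 : ∀ t : ℝ, (1 + b1*t^2 + b2*t^4)^2 + q^2 * (a0*t+a1*t^3+a2*t^5)^2 =
      (1 + s * t^2) * (1 + g1*t^2 + g2*t^4)^2)
    (h3 : ∀ t : ℝ, (a0+3*a1*t^2+5*a2*t^4) * (1 + b1*t^2 + b2*t^4) -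
      (a0*t+a1*t^3+a2*t^5) * (2*b1*t+4*b2*t^3) =
      a0 * (1 + f1*t^2 + f2*t^4) * (1 + g1*t^2 + g2*t^4)) :
    (IntegrableOn (fun v : ℝ => 1 / √((1 - v^2) * (e^2 + v^2))) (Ioo 0 1) ↔
    IntegrableOn (fun t : ℝ => m * (1 / √((1 - t^2) * (1 + s * t^2)))) (Ioo 0 1)) ∧
    ∫ v in Ioo (0:ℝ) 1, 1 / √((1 - v^2) * (e^2 + v^2)) =
    ∫ t in Ioo (0:ℝ) 1, m * (1 / √((1 - t^2) * (1 + s * t^2))) := by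
  have hs2 : ∀ t ∈ Ioo (0:ℝ) 1, t^2 < 1 := fun t ht => pow_lt_one₀ ht.1.le ht.2 (by norm_num)
  apply subst01 (fun t => (a0*t+a1*t^3+a2*t^5)/(1 + b1*t^2 + b2*t^4))
    (fun t => a0 * (1 + f1*t^2 + f2*t^4) * (1 + g1*t^2 + g2*t^4)/(1 + b1*t^2 + b2*t^4)^2)
  · apply ContinuousOn.div (by fun_prop) (by fun_prop)
    intro x hx; exact (hD x hx.1 hx.2).ne'
  · simp
  · have := (hD 1 (by norm_num) le_rfl).ne'
    simp only [one_pow, mul_one] at this ⊢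
    rw [hsum, div_self this]
  · intro t ht
    have hD' := (hD t ht.1.le ht.2.le).ne'
    have := ((((hasDerivAt_id' t).const_mul a0).add ((hasDerivAt_pow 3 t).const_mul a1)).add
      ((hasDerivAt_pow 5 t).const_mul a2)).div
      ((((hasDerivAt_pow 2 t).const_mul b1).const_add 1).add ((hasDerivAt_pow 4 t).const_mul b2)) hD'
    refine HasDerivAt.congr_deriv this ?_
    rw [← h3]
    congr 1
    push_cast
    simp only [Pi.add_apply]
    ring
  · intro t ht
    have := hD t ht.1.le ht.2.le
    have := hF t ht.1.le ht.2.le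
    have := hG t ht.1.le ht.2.le
    positivity
  · intro t ht
    have hDt := hD t ht.1.le ht.2.le
    have hFt := hF t ht.1.le ht.2.le
    have hGt := hG t ht.1.le ht.2.le
    have h5 := hs2 t ht
    have e1 := h1 t
    have e2 := h2 t
    apply pt_helper _ _ (e * (1 + f1*t^2 + f2*t^4) * (1 + g1*t^2 + g2*t^4)/(1 + b1*t^2 + b2*t^4)^2)
    · generalize (1 + b1*t^2 + b2*t^4) = D at *
      generalize (1 + f1*t^2 + f2*t^4) = F at *
      generalize (1 + g1*t^2 + g2*t^4) = G at *
      generalize (a0*t+a1*t^3+a2*t^5) = N at *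
      have a1 : 1 - (N/D)^2 = (1 - t^2) * F^2 / D^2 := by
        rw [← e1]; field_simp
      have a2 : e^2 + (N/D)^2 = e^2 * ((1 + s * t^2) * G^2 / D^2) := by
        rw [← e2]; field_simp
        have : e^2*q^2 = 1 := by rw [← mul_pow, mul_comm, hq, one_pow]
        linear_combination (-N^2) * this
      rw [a1, a2]; field_simp
    · positivity
    · exact mul_nonneg (by linarith) (by positivity)
    · rw [← hma]; ring
lemma c_bounds (c : ℝ) (h0 : 0 < c) (hc : c^4 = 5) :
    (14953487812212205419118/10^22 : ℝ) < c ∧ c < (14953487812212205419119/10^22 : ℝ) ∧ (14953487812212205419118/10^22 : ℝ)^2 < c^2 ∧ c^2 < (14953487812212205419119/10^22 : ℝ)^2 ∧ (14953487812212205419118/10^22 : ℝ)^3 < c^3 ∧ c^3 < (14953487812212205419119/10^22 : ℝ)^3 := by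
  have hl : (14953487812212205419118/10^22 : ℝ) < c := by
    apply lt_of_pow_lt_pow_left₀ 4 h0.le
    rw [hc]; norm_num
  have hu : c < (14953487812212205419119/10^22 : ℝ) := by
    apply lt_of_pow_lt_pow_left₀ 4 (by norm_num)
    rw [hc]; norm_num
  exact ⟨hl, hu, pow_lt_pow_left₀ hl (by norm_num) (by norm_num), pow_lt_pow_left₀ hu h0.le (by norm_num),
    pow_lt_pow_left₀ hl (by norm_num) (by norm_num), pow_lt_pow_left₀ hu h0.le (by norm_num)⟩

lemma quad_pos (x y t : ℝ) (hy : 0 ≤ y) (hx : x ≤ 0) (h : 0 < 1 + x + y) (h2 : 2 * y ≤ -x)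
    (ht : t^2 ≤ 1) : 0 < 1 + x*t^2 + y*t^4 := by
  have : t^4 = (t^2)^2 := by ring
  rw [this]
  have h0 : 0 ≤ t^2 := sq_nonneg t
  generalize t^2 = u at *
  nlinarith [mul_nonneg (sub_nonneg.2 ht) (show 0 ≤ -x - 2*y by linarith), mul_nonneg hy (sq_nonneg (1-u))]

open MeasureTheory Set in
lemma subP2 (c : ℝ) (h0 : 0 < c) (hc : c^4 = 5) :
    (IntegrableOn (fun v : ℝ => 1 / √((1 - v^2) * ((1)^2 + v^2))) (Ioo 0 1) ↔
    IntegrableOn (fun t : ℝ => (135 - 90*c^1 + 60*c^2 - 40*c^3) * (1 / √((1 - t^2) * (1 + (103681 - 69336*c^1 + 46368*c^2 - 31008*c^3) * t^2)))) (Ioo 0 1)) ∧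
    ∫ v in Ioo (0:ℝ) 1, 1 / √((1 - v^2) * ((1)^2 + v^2)) =
    ∫ t in Ioo (0:ℝ) 1, (135 - 90*c^1 + 60*c^2 - 40*c^3) * (1 / √((1 - t^2) * (1 + (103681 - 69336*c^1 + 46368*c^2 - 31008*c^3) * t^2))) := by
  obtain ⟨hl, hu, h2l, h2u, h3l, h3u⟩ := c_bounds c h0 hc
  have ht2 : ∀ t : ℝ, 0 ≤ t → t ≤ 1 → t^2 ≤ 1 := fun t h h' => pow_le_one₀ h h'
  apply subRat (135 - 90*c^1 + 60*c^2 - 40*c^3) (-418750 + 280035*c^1 - 187270*c^2 + 125235*c^3) (2631126 - 1759540*c^1 + 1176675*c^2 - 786890*c^3) (16500 - 11035*c^1 + 7380*c^2 - 4935*c^3) (2196010 - 1468560*c^1 + 982085*c^2 - 656760*c^3)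
    (-19612 + 13115*c^1 - 8770*c^2 + 5865*c^3) (2631126 - 1759540*c^1 + 1176675*c^2 - 786890*c^3) (772 - 517*c^1 + 346*c^2 - 231*c^3) (4086 - 2732*c^1 + 1827*c^2 - 1222*c^3) (1) (103681 - 69336*c^1 + 46368*c^2 - 31008*c^3) (135 - 90*c^1 + 60*c^2 - 40*c^3) (1)
  · ring
  · linarith
  · linarith
  · linear_combination (0) * hc
  · linear_combination (0) * hc
  · intro t h h'
    have hx : -(12/10) < (16500 - 11035*c^1 + 7380*c^2 - 4935*c^3) := by linarith
    have hy : 0 < (2196010 - 1468560*c^1 + 982085*c^2 - 656760*c^3) := by linarith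
    have hz : (16500 - 11035*c^1 + 7380*c^2 - 4935*c^3) < 0 := by linarith
    have hxy : 0 < 1 + (16500 - 11035*c^1 + 7380*c^2 - 4935*c^3) + (2196010 - 1468560*c^1 + 982085*c^2 - 656760*c^3) := by linarith
    exact quad_pos _ _ t hy.le hz.le hxy (by linarith) (ht2 t h h')
  · intro t h h'
    have hx : -(12/10) < (-19612 + 13115*c^1 - 8770*c^2 + 5865*c^3) := by linarith
    have hy : 0 < (2631126 - 1759540*c^1 + 1176675*c^2 - 786890*c^3) := by linarith
    have hz : (-19612 + 13115*c^1 - 8770*c^2 + 5865*c^3) < 0 := by linarith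
    have hxy : 0 < 1 + (-19612 + 13115*c^1 - 8770*c^2 + 5865*c^3) + (2631126 - 1759540*c^1 + 1176675*c^2 - 786890*c^3) := by linarith
    exact quad_pos _ _ t hy.le hz.le hxy (by linarith) (ht2 t h h')
  · intro t h h'
    have hx : 0 < (772 - 517*c^1 + 346*c^2 - 231*c^3) := by linarith
    have hy : 0 < (4086 - 2732*c^1 + 1827*c^2 - 1222*c^3) := by linarith
    positivity
  · linarith
  · intro t
    linear_combination ((-10800)*c^0*t^2 + (4800)*c^1*t^2 + (-1600)*c^2*t^2 + (45500)*c^0*t^4 + (21700)*c^1*t^4 + (-25200)*c^2*t^4 + (91500)*c^0*t^6 + (-199300)*c^1*t^6 + (82700)*c^2*t^6 + (-126200)*c^0*t^8 + (172800)*c^1*t^8 + (-55900)*c^2*t^8) * hc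
  · intro t
    linear_combination ((10800)*c^0*t^2 + (-4800)*c^1*t^2 + (1600)*c^2*t^2 + (-578380)*c^0*t^4 + (208604)*c^1*t^4 + (-43632)*c^2*t^4 + (-37176897900)*c^0*t^6 + (41435708852)*c^1*t^6 + (-33242547788)*c^2*t^6 + (22230394392)*c^3*t^6 + (-7430933664)*c^4*t^6 + (1654617888)*c^5*t^6 + (-392954833160)*c^0*t^8 + (437974972032)*c^1*t^8 + (-351426511780)*c^2*t^8 + (235013342496)*c^3*t^8 + (-78571859136)*c^4*t^8 + (17506000512)*c^5*t^8 + (-1038365735040)*c^0*t^10 + (1157355770880)*c^1*t^10 + (-928796203584)*c^2*t^10 + (621123343104)*c^3*t^10 + (-207697142016)*c^4*t^10 + (46303750272)*c^5*t^10) * hc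
  · intro t
    linear_combination ((188070)*c^0*t^2 + (-83700)*c^1*t^2 + (27960)*c^2*t^2 + (1219478880)*c^0*t^4 + (-1359428950)*c^1*t^4 + (1090466700)*c^2*t^4 + (-729090550)*c^3*t^4 + (243495300)*c^4*t^4 + (-54192600)*c^5*t^4 + (-157284429620)*c^0*t^6 + (175194052800)*c^1*t^6 + (-140512667130)*c^2*t^6 + (93966341400)*c^3*t^6 + (-31382016400)*c^4*t^6 + (6984182400)*c^5*t^6 + (-865324718880)*c^0*t^8 + (963874361600)*c^1*t^8 + (-773190968880)*c^2*t^8 + (517063918400)*c^3*t^8 + (-172716570000)*c^4*t^8 + (38463183200)*c^5*t^8) * hc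

open MeasureTheory Set in
lemma subQ2 (c : ℝ) (h0 : 0 < c) (hc : c^4 = 5) :
    (IntegrableOn (fun v : ℝ => 1 / √((1 - v^2) * ((161 - 108*c^1 + 72*c^2 - 48*c^3)^2 + v^2))) (Ioo 0 1) ↔
    IntegrableOn (fun t : ℝ => (3 + 2*c^1) * (1 / √((1 - t^2) * (1 + (1) * t^2)))) (Ioo 0 1)) ∧
    ∫ v in Ioo (0:ℝ) 1, 1 / √((1 - v^2) * ((161 - 108*c^1 + 72*c^2 - 48*c^3)^2 + v^2)) =
    ∫ t in Ioo (0:ℝ) 1, (3 + 2*c^1) * (1 / √((1 - t^2) * (1 + (1) * t^2))) := by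
  obtain ⟨hl, hu, h2l, h2u, h3l, h3u⟩ := c_bounds c h0 hc
  have ht2 : ∀ t : ℝ, 0 ≤ t → t ≤ 1 → t^2 ≤ 1 := fun t h h' => pow_le_one₀ h h'
  apply subRat (3 - 2*c^1) (-10 + 3*c^1 - 2*c^2 + 3*c^3) (6 - 4*c^1 + 3*c^2 - 2*c^3) (-3*c^1 + 1*c^3) (-2 + 1*c^2)
    (-4 + 3*c^1 - 2*c^2 + 1*c^3) (6 - 4*c^1 + 3*c^2 - 2*c^3) (4 + 3*c^1 + 2*c^2 + 1*c^3) (6 + 4*c^1 + 3*c^2 + 2*c^3) (161 - 108*c^1 + 72*c^2 - 48*c^3) (1) (3 + 2*c^1) (161 + 108*c^1 + 72*c^2 + 48*c^3)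
  · ring
  · linarith
  · linarith
  · linear_combination ((-5184)*c^0 + (-2304)*c^2) * hc
  · linear_combination ((-96)*c^0) * hc
  · intro t h h'
    have hx : -(12/10) < (-3*c^1 + 1*c^3) := by linarith
    have hy : 0 < (-2 + 1*c^2) := by linarith
    have hz : (-3*c^1 + 1*c^3) < 0 := by linarith
    have hxy : 0 < 1 + (-3*c^1 + 1*c^3) + (-2 + 1*c^2) := by linarith
    exact quad_pos _ _ t hy.le hz.le hxy (by linarith) (ht2 t h h')
  · intro t h h'
    have hx : -(12/10) < (-4 + 3*c^1 - 2*c^2 + 1*c^3) := by linarith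
    have hy : 0 < (6 - 4*c^1 + 3*c^2 - 2*c^3) := by linarith
    have hz : (-4 + 3*c^1 - 2*c^2 + 1*c^3) < 0 := by linarith
    have hxy : 0 < 1 + (-4 + 3*c^1 - 2*c^2 + 1*c^3) + (6 - 4*c^1 + 3*c^2 - 2*c^3) := by linarith
    exact quad_pos _ _ t hy.le hz.le hxy (by linarith) (ht2 t h h')
  · intro t h h'
    have hx : 0 < (4 + 3*c^1 + 2*c^2 + 1*c^3) := by linarith
    have hy : 0 < (6 + 4*c^1 + 3*c^2 + 2*c^3) := by linarith
    positivity
  · linarith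
  · intro t
    linear_combination ((-4)*c^0*t^4 + (4)*c^1*t^4 + (12)*c^0*t^6 + (-4)*c^1*t^6 + (-4)*c^2*t^6 + (-8)*c^0*t^8 + (4)*c^2*t^8) * hc
  · intro t
    linear_combination ((-46656)*c^0*t^2 + (-384)*c^1*t^2 + (9216)*c^4*t^2 + (311060)*c^0*t^4 + (116636)*c^1*t^4 + (139200)*c^2*t^4 + (-62208)*c^4*t^4 + (-23040)*c^5*t^4 + (-27648)*c^6*t^4 + (-705036)*c^0*t^6 + (-385996)*c^1*t^6 + (-626972)*c^2*t^6 + (-170280)*c^3*t^6 + (39456)*c^4*t^6 + (78624)*c^5*t^6 + (126144)*c^6*t^6 + (34560)*c^7*t^6 + (20736)*c^8*t^6 + (622120)*c^0*t^8 + (233280)*c^1*t^8 + (589468)*c^2*t^8 + (116640)*c^3*t^8 + (14784)*c^4*t^8 + (-46080)*c^5*t^8 + (-117504)*c^6*t^8 + (-23040)*c^7*t^8 + (-27648)*c^8*t^8 + (-186624)*c^0*t^10 + (-1536)*c^1*t^10 + (-186624)*c^2*t^10 + (-1536)*c^3*t^10 + (-9792)*c^4*t^10 + (-384)*c^5*t^10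 + (36864)*c^6*t^10 + (9216)*c^8*t^10) * hc
  · intro t
    linear_combination ((6)*c^0*t^2 + (-12)*c^0*t^4 + (2)*c^1*t^4 + (2)*c^3*t^4 + (4)*c^0*t^6 + (12)*c^1*t^6 + (-10)*c^2*t^6 + (24)*c^0*t^8 + (-16)*c^1*t^8 + (12)*c^2*t^8 + (-8)*c^3*t^8) * hc
open MeasureTheory Set ProbabilityTheory in
lemma I_val (c : ℝ) (h0 : 0 < c) (hc : c^4 = 5) :
    ∫ s in Ioo (0:ℝ) 1, s ^ 2 / √((1 - s ^ 4) * (1 - 80/81 * s ^ 4)) =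
      9 / (5 * c) * (beta (1/4) (1/2) / 4) := by
  obtain ⟨hl, hu, h2l, h2u, h3l, h3u⟩ := c_bounds c h0 hc
  obtain ⟨hJi, hJ⟩ := mono_int 0
  have eJ : (fun s : ℝ => s ^ 0 / √(1 - s ^ 4)) = fun v : ℝ => 1 / √((1 - v^2) * (1 + v^2)) := by
    funext s
    rw [pow_zero]; congr 2; ring
  rw [eJ] at hJi hJ
  simp only [Nat.cast_zero, zero_add] at hJ
  obtain ⟨p1, p2⟩ := subP2 c h0 hc
  obtain ⟨q1, q2⟩ := subQ2 c h0 hc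
  have hM : (135 - 90*c^1 + 60*c^2 - 40*c^3) = 5 / (3 + 2*c) := by
    rw [eq_div_iff (by positivity)]
    linear_combination (-80) * hc
  have hk0 : 0 < 2*c/3 := by positivity
  have hk1 : 2*c/3 < 1 := by linarith
  have he : (1 - 2*c/3)/(1 + 2*c/3) = (161 - 108*c^1 + 72*c^2 - 48*c^3) := by
    rw [div_eq_iff (by positivity)]
    linear_combination (32) * hc
  have he2 : (161 - 108*c^1 + 72*c^2 - 48*c^3)^2 = (103681 - 69336*c^1 + 46368*c^2 - 31008*c^3) := by
    linear_combination (15552 - 6912*c + 2304*c^2) * hc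
  obtain ⟨p3, p4⟩ := subP1 (2*c/3) hk0 hk1
  obtain ⟨q3, q4⟩ := subQ1 (2*c/3) hk0 hk1
  have hk4 : (2*c/3)^4 = 80/81 := by linear_combination (16/81) * hc
  rw [he, hk4] at p3 p4 q3 q4
  rw [he2] at p3 p4
  rw [hM] at p1 p2
  rw [one_pow] at p1 p2
  simp only [one_mul, pow_one] at q1 q2 p1 p2 p3 p4 q3 q4
  rw [integral_const_mul] at p2 q2
  rw [hJ] at p2 q2
  have hgQ := q3.1 (q1.2 (hJi.const_mul _))
  have hgP := p3.1 (by
    have h := (p1.1 hJi).const_mul ((3 + 2*c)/5)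
    refine (integrableOn_congr_fun ?_ measurableSet_Ioo).1 h
    intro x _
    field_simp)
  have hsub := integral_sub hgQ hgP
  rw [← p4, ← q4, q2] at hsub
  have hI : ∫ s in Ioo (0:ℝ) 1, ((1 + 2*c/3)*(1 + 2*c/3*s^2) * (1 / √((1 - s^4) * (1 - 80/81*s^4)))
      - (1 + 2*c/3)*(1 - 2*c/3*s^2) * (1 / √((1 - s^4) * (1 - 80/81*s^4)))) =
      (2*(2*c/3)*(1 + 2*c/3)) *
      ∫ s in Ioo (0:ℝ) 1, s ^ 2 / √((1 - s ^ 4) * (1 - 80/81 * s ^ 4)) := by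
    rw [← integral_const_mul]
    congr 1; funext s; ring
  rw [hI] at hsub
  generalize (∫ s in Ioo (0:ℝ) 1, s ^ 2 / √((1 - s ^ 4) * (1 - 80/81 * s ^ 4))) = I at *
  clear hJ q2 q4 p4
  generalize (∫ v in Ioo (0:ℝ) 1, 1 / √((1 - v ^ 2) * (1 + (103681 - 69336 * c + 46368 * c ^ 2 - 31008 * c ^ 3) * v ^ 2))) = P0 at *
  generalize beta (1/4) (1/2) / 4 = J at *
  have hP0 : P0 = (3 + 2*c)/5 * J := by rw [p2]; field_simp
  rw [hP0] at hsub
  have h3 : 0 < 3 + 2*c := by positivity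
  have : (4*c*(3+2*c)/9) * I = (4*c*(3+2*c)/9) * (9/(5*c)*J) := by
    calc _ = (2*(2*c/3)*(1 + 2*c/3)) * I := by ring
      _ = _ := by rw [hsub]; field_simp; ring
  exact mul_left_cancel₀ (by positivity) this

theorem stmt11 : twoFone (1/2) (3/4) (5/4) (80/81) = (9/200) * (5:ℝ) ^ ((3:ℝ)/4) * Real.Gamma (1/4) ^ 4 / Real.pi ^ 2 := by
  have h5 : ((5:ℝ) ^ ((1:ℝ)/4)) ^ 4 = 5 := by
    rw [← Real.rpow_natCast, ← Real.rpow_mul (by norm_num)]; norm_num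
  have h53 : (5:ℝ) ^ ((3:ℝ)/4) = ((5:ℝ) ^ ((1:ℝ)/4)) ^ 3 := by
    rw [← Real.rpow_natCast, ← Real.rpow_mul (by norm_num)]; norm_num
  have h0 : 0 < (5:ℝ) ^ ((1:ℝ)/4) := by positivity
  rw [h53]
  generalize (5:ℝ) ^ ((1:ℝ)/4) = c at *
  have hs := series_int
  rw [I_val c h0 h5] at hs
  unfold ProbabilityTheory.beta at hs
  rw [show (1/4 + 1/2 : ℝ) = 3/4 by norm_num, show (3/4 + 1/2 : ℝ) = 1/4 + 1 by norm_num,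
    Real.Gamma_add_one (by norm_num)] at hs
  have hr := Real.Gamma_mul_Gamma_one_sub (1/4)
  rw [show (1 - 1/4 : ℝ) = 3/4 by norm_num, show Real.pi * (1/4) = Real.pi / 4 by ring,
    Real.sin_pi_div_four] at hr
  have g1 := Real.Gamma_pos_of_pos (show (0:ℝ) < 1/4 by norm_num)
  have g2 := Real.Gamma_pos_of_pos (show (0:ℝ) < 1/2 by norm_num)
  have g3 := Real.Gamma_pos_of_pos (show (0:ℝ) < 3/4 by norm_num)
  generalize Real.Gamma (1/4) = A at *
  generalize Real.Gamma (1/2) = H at *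
  generalize Real.Gamma (3/4) = G at *
  generalize twoFone (1/2) (3/4) (5/4) (80/81) = T at *
  have hpi := Real.pi_pos
  have hr2 : A^2 * G^2 = 2 * Real.pi^2 := by
    have h2 : √(2:ℝ)^2 = 2 := Real.sq_sqrt (by norm_num)
    have h2' : √(2:ℝ) ≠ 0 := by positivity
    rw [← mul_pow, hr]
    field_simp
    linear_combination (-1) * h2
  have hT : T = 9 / (20 * c) * A^2 / G^2 := by
    field_simp at hs ⊢
    linarith
  rw [hT, div_eq_div_iff (by positivity) (by positivity)]
  have : 9 / (20 * c) = 9/100 * c^3 := by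
    field_simp
    linear_combination (-20) * h5
  rw [this]
  linear_combination (-(9/200) * c^3 * A^2) * hr2
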